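/- Let ω ∈ (0,1) and define W_ω : closure(D) → ℝ by W_ω(x,y) = √2 (1 − x² − y²) / ((1−ωx)² + ω²y²), where D is the open unit disk in ℝ². Then: (i) W_ω(ω,0) = √2/(1−ω²); (ii) (ω,0) is the strict global maximum point of W_ω on closure(D), i.e. W_ω(ξ) < W_ω(ω,0) for every ξ ∈ closure(D) with ξ ≠ (ω,0); and (iii) the Hessian matrix of W_ω at (ω,0) equals −(2√2/(1−ω²)³) times the 2×2 identity matrix (in particular it is negative definite, so the maximum is non-degenerate). -/

import Mathlib

noncomputable section

/-- Partial derivative in the first coordinate. -/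
def pdx {E : Type*} [NormedAddCommGroup E] [NormedSpace ℝ E] (f : ℝ × ℝ → E) (p : ℝ × ℝ) : E :=
  fderiv ℝ f p (1, 0)

/-- Partial derivative in the second coordinate. -/
def pdy {E : Type*} [NormedAddCommGroup E] [NormedSpace ℝ E] (f : ℝ × ℝ → E) (p : ℝ × ℝ) : E :=
  fderiv ℝ f p (0, 1)

theorem pdx_eq_of_hasDerivAt {E : Type*} [NormedAddCommGroup E] [NormedSpace ℝ E]
    {f : ℝ × ℝ → E} {p : ℝ × ℝ} {d : E} (hf : DifferentiableAt ℝ f p)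
    (hd : HasDerivAt (fun x => f (x, p.2)) d p.1) : pdx f p = d := by
  have hl : HasDerivAt (fun x : ℝ => (x, p.2)) ((1 : ℝ), (0 : ℝ)) p.1 :=
    (hasDerivAt_id p.1).prodMk (hasDerivAt_const p.1 p.2)
  exact (HasFDerivAt.comp_hasDerivAt (f := fun x : ℝ => (x, p.2)) p.1
    hf.hasFDerivAt hl).unique hd

theorem pdy_eq_of_hasDerivAt {E : Type*} [NormedAddCommGroup E] [NormedSpace ℝ E]
    {f : ℝ × ℝ → E} {p : ℝ × ℝ} {d : E} (hf : DifferentiableAt ℝ f p)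
    (hd : HasDerivAt (fun y => f (p.1, y)) d p.2) : pdy f p = d := by
  have hl : HasDerivAt (fun y : ℝ => (p.1, y)) ((0 : ℝ), (1 : ℝ)) p.2 :=
    (hasDerivAt_const p.2 p.1).prodMk (hasDerivAt_id p.2)
  exact (HasFDerivAt.comp_hasDerivAt (f := fun y : ℝ => (p.1, y)) p.2
    hf.hasFDerivAt hl).unique hd

theorem pdx_congr_of_eventuallyEq {E : Type*} [NormedAddCommGroup E] [NormedSpace ℝ E]
    {f g : ℝ × ℝ → E} {p : ℝ × ℝ} (h : f =ᶠ[nhds p] g) : pdx f p = pdx g p := by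
  rw [pdx, pdx, h.fderiv_eq]

theorem pdy_congr_of_eventuallyEq {E : Type*} [NormedAddCommGroup E] [NormedSpace ℝ E]
    {f g : ℝ × ℝ → E} {p : ℝ × ℝ} (h : f =ᶠ[nhds p] g) : pdy f p = pdy g p := by
  rw [pdy, pdy, h.fderiv_eq]

theorem hasDerivAt_denom_fst (ω x y : ℝ) :
    HasDerivAt (fun x : ℝ => (1 - ω * x) ^ 2 + ω ^ 2 * y ^ 2) (-2 * ω * (1 - ω * x)) x := by
  refine HasDerivAt.congr_deriv
        (((((hasDerivAt_id x).const_mul ω).const_sub 1).fun_pow 2).add_const (ω ^ 2 * y ^ 2)) ?_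
  simp
  ring

theorem hasDerivAt_denom_snd (ω x y : ℝ) :
    HasDerivAt (fun y : ℝ => (1 - ω * x) ^ 2 + ω ^ 2 * y ^ 2) (2 * ω ^ 2 * y) y := by
  refine HasDerivAt.congr_deriv
        ((((hasDerivAt_id y).fun_pow 2).const_mul (ω ^ 2)).const_add ((1 - ω * x) ^ 2)) ?_
  simp
  ring

theorem hasDerivAt_numer_fst (c x y : ℝ) :
    HasDerivAt (fun x : ℝ => c * (1 - x ^ 2 - y ^ 2)) (-2 * c * x) x := by
  refine HasDerivAt.congr_deriv
        (((((hasDerivAt_id x).fun_pow 2).const_sub 1).sub_const (y ^ 2)).const_mul c) ?_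
  simp
  ring

theorem hasDerivAt_numer_snd (c x y : ℝ) :
    HasDerivAt (fun y : ℝ => c * (1 - x ^ 2 - y ^ 2)) (-2 * c * y) y := by
  refine HasDerivAt.congr_deriv
        ((((hasDerivAt_id y).fun_pow 2).const_sub (1 - x ^ 2)).const_mul c) ?_
  simp
  ring

theorem pdx_quotient (c ω : ℝ) {p : ℝ × ℝ} (hp : (1 - ω * p.1) ^ 2 + ω ^ 2 * p.2 ^ 2 ≠ 0) :
    pdx (fun p : ℝ × ℝ =>
      c * (1 - p.1 ^ 2 - p.2 ^ 2) / ((1 - ω * p.1) ^ 2 + ω ^ 2 * p.2 ^ 2)) p =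
    2 * c * ((ω - p.1) * (1 - ω * p.1) - ω * p.2 ^ 2) /
      ((1 - ω * p.1) ^ 2 + ω ^ 2 * p.2 ^ 2) ^ 2 := by
  apply pdx_eq_of_hasDerivAt
  · fun_prop (disch := assumption)
  · refine HasDerivAt.congr_deriv
        ((hasDerivAt_numer_fst c p.1 p.2).fun_div (hasDerivAt_denom_fst ω p.1 p.2) hp) ?_
    ring

theorem pdy_quotient (c ω : ℝ) {p : ℝ × ℝ} (hp : (1 - ω * p.1) ^ 2 + ω ^ 2 * p.2 ^ 2 ≠ 0) :
    pdy (fun p : ℝ × ℝ =>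
      c * (1 - p.1 ^ 2 - p.2 ^ 2) / ((1 - ω * p.1) ^ 2 + ω ^ 2 * p.2 ^ 2)) p =
    -2 * c * (p.2 * (1 + ω ^ 2 - 2 * ω * p.1)) /
      ((1 - ω * p.1) ^ 2 + ω ^ 2 * p.2 ^ 2) ^ 2 := by
  apply pdy_eq_of_hasDerivAt
  · fun_prop (disch := assumption)
  · refine HasDerivAt.congr_deriv
        ((hasDerivAt_numer_snd c p.1 p.2).fun_div (hasDerivAt_denom_snd ω p.1 p.2) hp) ?_
    ring

/-- Properties of `W_ω(x,y) = √2(1−x²−y²)/((1−ωx)²+ω²y²)` on the closed unit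
disk: value at `(ω,0)`, strict global maximality at `(ω,0)`, and its Hessian at
`(ω,0)` is `−(2√2/(1−ω²)³)` times the identity. -/
theorem statement13
    (ω : ℝ) (hω : ω ∈ Set.Ioo (0 : ℝ) 1)
    (W : ℝ × ℝ → ℝ)
    (hW : ∀ p : ℝ × ℝ, W p =
      Real.sqrt 2 * (1 - p.1 ^ 2 - p.2 ^ 2) / ((1 - ω * p.1) ^ 2 + ω ^ 2 * p.2 ^ 2)) :
    (W (ω, 0) = Real.sqrt 2 / (1 - ω ^ 2)) ∧
    (∀ p : ℝ × ℝ, p.1 ^ 2 + p.2 ^ 2 ≤ 1 → p ≠ (ω, 0) → W p < W (ω, 0)) ∧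
    (pdx (pdx W) (ω, 0) = -(2 * Real.sqrt 2 / (1 - ω ^ 2) ^ 3) ∧
     pdy (pdx W) (ω, 0) = 0 ∧
     pdx (pdy W) (ω, 0) = 0 ∧
     pdy (pdy W) (ω, 0) = -(2 * Real.sqrt 2 / (1 - ω ^ 2) ^ 3)) := by
  obtain ⟨h0, h1⟩ := hω
  have hs : 0 < Real.sqrt 2 := by positivity
  have hw : 0 < 1 - ω ^ 2 := by nlinarith
  have hval : W (ω, 0) = Real.sqrt 2 / (1 - ω ^ 2) := by
    rw [hW]
    field_simp
    ring
  refine ⟨hval, ?_, ?_⟩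
  · rintro ⟨x, y⟩ hxy hne
    dsimp only at hxy
    have hx : x ≤ 1 := by nlinarith [sq_nonneg y]
    have hD : 0 < (1 - ω * x) ^ 2 + ω ^ 2 * y ^ 2 := by
      have : 0 < 1 - ω * x := by nlinarith
      positivity
    have hQ : 0 < (x - ω) ^ 2 + y ^ 2 := by
      by_contra! h
      apply hne
      ext <;> dsimp only <;> nlinarith [sq_nonneg (x - ω), sq_nonneg y]
    rw [hval, hW, div_lt_div_iff₀ hD hw]
    nlinarith [mul_pos hs hQ]
  · obtain rfl : W = _ := funext hW
    have hD0 : (1 - ω * ω) ^ 2 + ω ^ 2 * (0 : ℝ) ^ 2 ≠ 0 := by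
      have : 0 < 1 - ω * ω := by nlinarith
      positivity
    have hev : ∀ᶠ p : ℝ × ℝ in nhds (ω, 0), (1 - ω * p.1) ^ 2 + ω ^ 2 * p.2 ^ 2 ≠ 0 :=
      ContinuousAt.eventually_ne (by fun_prop) hD0
    have hD0' : ((1 - ω * ω) ^ 2 + ω ^ 2 * (0 : ℝ) ^ 2) ^ 2 ≠ 0 := pow_ne_zero 2 hD0
    have hx := hev.mono fun p hp => pdx_quotient (Real.sqrt 2) ω hp
    have hy := hev.mono fun p hp => pdy_quotient (Real.sqrt 2) ω hp
    have hDx := (hasDerivAt_denom_fst ω ω 0).fun_pow 2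
    have hDy := (hasDerivAt_denom_snd ω ω 0).fun_pow 2
    have hne : 1 - ω ^ 2 ≠ 0 := hw.ne'
    rw [pdx_congr_of_eventuallyEq hx, pdy_congr_of_eventuallyEq hx,
      pdx_congr_of_eventuallyEq hy, pdy_congr_of_eventuallyEq hy]
    refine ⟨?_, ?_, ?_, ?_⟩
    · apply pdx_eq_of_hasDerivAt
      · fun_prop (disch := assumption)
      · have hN : HasDerivAt
            (fun x => 2 * Real.sqrt 2 * ((ω - x) * (1 - ω * x) - ω * (0 : ℝ) ^ 2))
            (-2 * Real.sqrt 2 * (1 - ω ^ 2)) ω := by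
          refine HasDerivAt.congr_deriv ((((((hasDerivAt_id ω).const_sub ω).fun_mul
            (((hasDerivAt_id ω).const_mul ω).const_sub 1)).sub_const
              (ω * (0 : ℝ) ^ 2)).const_mul (2 * Real.sqrt 2))) ?_
          simp
          ring
        refine HasDerivAt.congr_deriv (hN.fun_div hDx hD0') ?_
        field_simp
        ring
    · apply pdy_eq_of_hasDerivAt
      · fun_prop (disch := assumption)
      · have hN : HasDerivAt
            (fun y => 2 * Real.sqrt 2 * ((ω - ω) * (1 - ω * ω) - ω * y ^ 2)) 0 (0 : ℝ) := by
          refine HasDerivAt.congr_deriv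
                ((((((hasDerivAt_id (0 : ℝ)).fun_pow 2).const_mul ω).const_sub
            ((ω - ω) * (1 - ω * ω))).const_mul (2 * Real.sqrt 2))) ?_
          simp
        refine HasDerivAt.congr_deriv (hN.fun_div hDy hD0') ?_
        simp
    · apply pdx_eq_of_hasDerivAt
      · fun_prop (disch := assumption)
      · simpa using hasDerivAt_const ω (0 : ℝ)
    · apply pdy_eq_of_hasDerivAt
      · fun_prop (disch := assumption)
      · have hN : HasDerivAt
            (fun y => -2 * Real.sqrt 2 * (y * (1 + ω ^ 2 - 2 * ω * ω)))
            (-2 * Real.sqrt 2 * (1 - ω ^ 2)) (0 : ℝ) := by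
          refine HasDerivAt.congr_deriv ((((hasDerivAt_id (0 : ℝ)).mul_const
            (1 + ω ^ 2 - 2 * ω * ω)).const_mul (-2 * Real.sqrt 2))) ?_
          ring
        refine HasDerivAt.congr_deriv (hN.fun_div hDy hD0') ?_
        field_simp
        ring
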